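/- arXiv:1602.04177 — 2 statements merged into one kernel-verified Lean document; each statement's English description precedes it below -/
import Mathlib

section
/- Let S be a real symmetric n×n matrix and let a, b be real numbers with a > 0 and a² ≤ b. Assume that every eigenvalue λ of S satisfies (a + b − λ)² < 4a(b − aλ). Then there exists ρ > 0 such that for all u, w ∈ ℝⁿ: a‖u‖² + b‖w‖² + (a + b)⟨u, w⟩ − ⟨Sw, u⟩ − a⟨Sw, w⟩ ≥ ρ(‖u‖² + ‖w‖²). -/
open Matrix

/-- A binary quadratic form with positive leading coefficient and negative discriminant dominates
every sufficiently small positive multiple of the Euclidean form. -/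
lemma eventually_le_binary_quadratic_form {p q r : ℝ} (hp : 0 < p) (hr : r ^ 2 < 4 * p * q) :
    ∀ᶠ ρ in nhdsWithin (0 : ℝ) (Set.Ioi 0), ∀ x y : ℝ,
      ρ * (x ^ 2 + y ^ 2) ≤ p * x ^ 2 + r * (x * y) + q * y ^ 2 := by
  have hq : 0 < q := pos_of_mul_pos_right ((sq_nonneg r).trans_lt hr) (by positivity)
  have hpq : 0 < 4 * (p + q) := by positivity
  filter_upwards [Ioc_mem_nhdsGT (div_pos (sub_pos.2 hr) hpq)] with ρ hρ x y
  obtain ⟨hρ_pos, hρ_le⟩ := hρ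
  rw [le_div_iff₀ hpq] at hρ_le
  have hρp : 0 < p - ρ := by
    by_contra! h
    nlinarith [sq_nonneg r, mul_pos hp hp]
  have hdisc : 0 ≤ 4 * (p - ρ) * (q - ρ) - r ^ 2 := by nlinarith [sq_nonneg ρ]
  have hsq : 0 ≤ 4 * (p - ρ) *
      (p * x ^ 2 + r * (x * y) + q * y ^ 2 - ρ * (x ^ 2 + y ^ 2)) := by
    calc 0 ≤ (2 * (p - ρ) * x + r * y) ^ 2 + (4 * (p - ρ) * (q - ρ) - r ^ 2) * y ^ 2 := by
          positivity
      _ = _ := by ring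
  exact sub_nonneg.1 (nonneg_of_mul_nonneg_right hsq (by positivity))

/-- A real symmetric matrix has an orthonormal eigenbasis, expressed through coordinates in which
the dot product and the bilinear form of the matrix are both diagonal. -/
lemma Matrix.IsSymm.exists_diagonalizing_coordinates {ι : Type*} [Fintype ι] [DecidableEq ι]
    {S : Matrix ι ι ℝ} (hS : S.IsSymm) :
    ∃ (l : ι → ℝ) (c : (ι → ℝ) → ι → ℝ),
      (∀ i, Module.End.HasEigenvalue (Matrix.toLin' S) (l i)) ∧
      (∀ u w, u ⬝ᵥ w = ∑ i, c u i * c w i) ∧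
      ∀ u w, S *ᵥ u ⬝ᵥ w = ∑ i, l i * (c u i * c w i) := by
  have hH : S.IsHermitian := by
    rwa [Matrix.IsHermitian, Matrix.conjTranspose_eq_transpose_of_trivial]
  let e := hH.eigenvectorBasis
  have hdot (u w : ι → ℝ) : u ⬝ᵥ w = ∑ i, (u ⬝ᵥ e i) * (w ⬝ᵥ e i) := by
    have h := e.sum_inner_mul_inner (WithLp.toLp 2 u) (WithLp.toLp 2 w)
    simp only [EuclideanSpace.inner_eq_star_dotProduct, star_trivial] at h
    rw [dotProduct_comm u w, ← h]
    exact Finset.sum_congr rfl fun i _ => by rw [dotProduct_comm u]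
  have hmul (u : ι → ℝ) (i : ι) : S *ᵥ u ⬝ᵥ e i = hH.eigenvalues i * (u ⬝ᵥ e i) := by
    rw [dotProduct_comm, dotProduct_mulVec, ← mulVec_transpose, hS.eq,
      hH.mulVec_eigenvectorBasis, smul_dotProduct, smul_eq_mul, dotProduct_comm]
  refine ⟨hH.eigenvalues, fun u i => u ⬝ᵥ e i, fun i => ?_, hdot, fun u w => ?_⟩
  · rw [Module.End.hasEigenvalue_iff_mem_spectrum, Matrix.spectrum_toLin']
    exact hH.eigenvalues_mem_spectrum_real i
  · rw [hdot]
    exact Finset.sum_congr rfl fun i _ => by rw [hmul, mul_assoc]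

/-- Positive definiteness of the quadratic form appearing in the proof of the
Wasserstein contraction for the kinetic Fokker–Planck equation: if `S` is a real
symmetric matrix, `a > 0`, `a² ≤ b`, and every eigenvalue `λ` of `S` satisfies the
discriminant condition `(a + b - λ)² < 4a(b - aλ)`, then the quadratic form
`a‖u‖² + b‖w‖² + (a + b)⟨u, w⟩ - ⟨Sw, u⟩ - a⟨Sw, w⟩` is uniformly positive definite. -/
theorem stmt3 {n : ℕ} (S : Matrix (Fin n) (Fin n) ℝ) (hS : S.IsSymm)
    (a b : ℝ) (ha : 0 < a) (hab : a ^ 2 ≤ b)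
    (heig : ∀ lam : ℝ, Module.End.HasEigenvalue (Matrix.toLin' S) lam →
      (a + b - lam) ^ 2 < 4 * a * (b - a * lam)) :
    ∃ ρ > 0, ∀ u w : Fin n → ℝ,
      a * (u ⬝ᵥ u) + b * (w ⬝ᵥ w) + (a + b) * (u ⬝ᵥ w)
        - S.mulVec w ⬝ᵥ u - a * (S.mulVec w ⬝ᵥ w)
        ≥ ρ * (u ⬝ᵥ u + w ⬝ᵥ w) := by
  obtain ⟨l, c, hl, hdot, hmul⟩ := hS.exists_diagonalizing_coordinates
  obtain ⟨ρ, hρ, hρ_pos⟩ := ((Filter.eventually_all.2 fun i =>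
    eventually_le_binary_quadratic_form ha (heig (l i) (hl i))).and self_mem_nhdsWithin).exists
  refine ⟨ρ, hρ_pos, fun u w => ?_⟩
  rw [hmul, hmul]
  simp only [hdot, Finset.mul_sum, ← Finset.sum_add_distrib, ← Finset.sum_sub_distrib]
  refine Finset.sum_le_sum fun i _ => ?_
  linear_combination hρ i (c u i) (c w i)
end

section
/- Let V : ℝⁿ → ℝ be smooth and let L be the kinetic Fokker–Planck operator Lf = Δᵥf − ⟨v, ∇ᵥf⟩ + ⟨∇V(x), ∇ᵥf⟩ − ⟨v, ∇ₓf⟩ acting on smooth functions f : ℝⁿ × ℝⁿ → ℝ. Fix α, β, γ, δ ∈ ℝ and define T(f,g) = ⟨α∇ₓf + β∇ᵥf, α∇ₓg + β∇ᵥg⟩ + ⟨γ∇ₓf + δ∇ᵥf, γ∇ₓg + δ∇ᵥg⟩, T(f) = T(f,f), and T₂(f) = ½(L(T(f)) − 2T(f, Lf)). Then for every smooth f and every point (x,v) ∈ ℝⁿ × ℝⁿ: T₂(f) ≥ (β² + δ²)‖∇ᵥf‖² + (αβ + γδ)‖∇ₓf‖² + (β² + δ² + αβ + γδ)⟨∇ᵥf,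 ∇ₓf⟩ − (α² + γ²)⟨∇²V(x)∇ᵥf, ∇ₓf⟩ − (αβ + γδ)⟨∇²V(x)∇ᵥf, ∇ᵥf⟩. -/
open scoped ContDiff

noncomputable section

/-- Partial derivative in the `i`-th `x`-variable of a function on `ℝⁿ × ℝⁿ`. -/
def gradx {n : ℕ} (f : (Fin n → ℝ) × (Fin n → ℝ) → ℝ)
    (p : (Fin n → ℝ) × (Fin n → ℝ)) (i : Fin n) : ℝ :=
  fderiv ℝ f p (Pi.single i 1, 0)

/-- Partial derivative in the `i`-th `v`-variable of a function on `ℝⁿ × ℝⁿ`. -/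
def gradv {n : ℕ} (f : (Fin n → ℝ) × (Fin n → ℝ) → ℝ)
    (p : (Fin n → ℝ) × (Fin n → ℝ)) (i : Fin n) : ℝ :=
  fderiv ℝ f p (0, Pi.single i 1)

/-- The Laplacian in the `v`-variables. -/
def lapv {n : ℕ} (f : (Fin n → ℝ) × (Fin n → ℝ) → ℝ)
    (p : (Fin n → ℝ) × (Fin n → ℝ)) : ℝ :=
  ∑ i, gradv (fun q => gradv f q i) p i

/-- Partial derivative of a function on `ℝⁿ`. -/
def grad1 {n : ℕ} (V : (Fin n → ℝ) → ℝ) (x : Fin n → ℝ) (i : Fin n) : ℝ :=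
  fderiv ℝ V x (Pi.single i 1)

/-- The Hessian matrix `∇²V(x)` of a function `V` on `ℝⁿ`. -/
def hess {n : ℕ} (V : (Fin n → ℝ) → ℝ) (x : Fin n → ℝ) (i j : Fin n) : ℝ :=
  fderiv ℝ (fun y => fderiv ℝ V y (Pi.single j 1)) x (Pi.single i 1)

/-- The kinetic Fokker–Planck operator
`Lf = Δᵥf - ⟨v, ∇ᵥf⟩ + ⟨∇V(x), ∇ᵥf⟩ - ⟨v, ∇ₓf⟩`. -/
def kfp {n : ℕ} (V : (Fin n → ℝ) → ℝ) (f : (Fin n → ℝ) × (Fin n → ℝ) → ℝ)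
    (p : (Fin n → ℝ) × (Fin n → ℝ)) : ℝ :=
  lapv f p - ∑ i, p.2 i * gradv f p i + ∑ i, grad1 V p.1 i * gradv f p i
    - ∑ i, p.2 i * gradx f p i

/-- The twisted gradient bilinear form
`T(f,g) = ⟨α∇ₓf + β∇ᵥf, α∇ₓg + β∇ᵥg⟩ + ⟨γ∇ₓf + δ∇ᵥf, γ∇ₓg + δ∇ᵥg⟩`. -/
def Tform {n : ℕ} (α β γ δ : ℝ) (f g : (Fin n → ℝ) × (Fin n → ℝ) → ℝ)
    (p : (Fin n → ℝ) × (Fin n → ℝ)) : ℝ :=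
  ∑ i, ((α * gradx f p i + β * gradv f p i) * (α * gradx g p i + β * gradv g p i)
      + (γ * gradx f p i + δ * gradv f p i) * (γ * gradx g p i + δ * gradv g p i))

/-- The iterated form `T₂(f) = ½(L(T(f)) - 2T(f, Lf))`. -/
def T2form {n : ℕ} (V : (Fin n → ℝ) → ℝ) (α β γ δ : ℝ)
    (f : (Fin n → ℝ) × (Fin n → ℝ) → ℝ) (p : (Fin n → ℝ) × (Fin n → ℝ)) : ℝ :=
  (1 / 2) * (kfp V (fun q => Tform α β γ δ f f q) p - 2 * Tform α β γ δ f (kfp V f) p)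

section DirectionalDerivatives

variable {E : Type*} [NormedAddCommGroup E] [NormedSpace ℝ E]

lemma ContDiff.fderiv_apply_const {f : E → ℝ} (hf : ContDiff ℝ ∞ f) (w : E) :
    ContDiff ℝ ∞ (fun q => fderiv ℝ f q w) :=
  (hf.fderiv_right (m := ∞) (by simp)).clm_apply contDiff_const

lemma ContDiff.differentiable_of_infty {f : E → ℝ} (hf : ContDiff ℝ ∞ f) :
    Differentiable ℝ f :=
  hf.differentiable (by simp)

lemma fderiv_fderiv_apply_comm {f : E → ℝ} (hf : ContDiff ℝ ∞ f) (u w p : E) :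
    fderiv ℝ (fun q => fderiv ℝ f q u) p w = fderiv ℝ (fun q => fderiv ℝ f q w) p u := by
  have hd : DifferentiableAt ℝ (fderiv ℝ f) p :=
    ((hf.fderiv_right (m := ∞) (by simp)).differentiable (by simp)) p
  rw [fderiv_clm_apply hd (differentiableAt_const u),
    fderiv_clm_apply hd (differentiableAt_const w)]
  have hs : IsSymmSndFDerivAt ℝ f p := hf.contDiffAt.isSymmSndFDerivAt (by
    rw [minSmoothness_of_isRCLikeNormedField]
    exact WithTop.coe_le_coe.2 (le_top : (2 : ℕ∞) ≤ ⊤))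
  simpa using hs.eq w u

lemma fderiv_mul_apply {f g : E → ℝ} (hf : ContDiff ℝ ∞ f) (hg : ContDiff ℝ ∞ g) (p w : E) :
    fderiv ℝ (fun q => f q * g q) p w = fderiv ℝ f p w * g p + f p * fderiv ℝ g p w := by
  rw [fderiv_fun_mul (hf.differentiable_of_infty p) (hg.differentiable_of_infty p)]
  simp only [add_apply, smul_apply, smul_eq_mul]
  ring

lemma fderiv_sum_apply {ι : Type*} {s : Finset ι} {F : ι → E → ℝ}
    (hF : ∀ k ∈ s, ContDiff ℝ ∞ (F k)) (p w : E) :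
    fderiv ℝ (fun q => ∑ k ∈ s, F k q) p w = ∑ k ∈ s, fderiv ℝ (F k) p w := by
  rw [fderiv_fun_sum fun k hk => (hF k hk).differentiable_of_infty p]
  simp

end DirectionalDerivatives

section KineticFokkerPlanck

variable {n : ℕ}

lemma mul_gradx_add_mul_gradv (a b : ℝ) (f : (Fin n → ℝ) × (Fin n → ℝ) → ℝ)
    (p : (Fin n → ℝ) × (Fin n → ℝ)) (i : Fin n) :
    a * gradx f p i + b * gradv f p i
      = fderiv ℝ f p (a • (Pi.single i 1, 0) + b • (0, Pi.single i 1)) := by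
  simp only [map_add, map_smul, smul_eq_mul, gradx, gradv]

lemma contDiff_gradx {f : (Fin n → ℝ) × (Fin n → ℝ) → ℝ} (hf : ContDiff ℝ ∞ f) (i : Fin n) :
    ContDiff ℝ ∞ (fun q => gradx f q i) :=
  hf.fderiv_apply_const _

lemma contDiff_gradv {f : (Fin n → ℝ) × (Fin n → ℝ) → ℝ} (hf : ContDiff ℝ ∞ f) (i : Fin n) :
    ContDiff ℝ ∞ (fun q => gradv f q i) :=
  hf.fderiv_apply_const _

lemma contDiff_grad1_fst {V : (Fin n → ℝ) → ℝ} (hV : ContDiff ℝ ∞ V) (i : Fin n) :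
    ContDiff ℝ ∞ (fun q : (Fin n → ℝ) × (Fin n → ℝ) => grad1 V q.1 i) :=
  (hV.fderiv_apply_const (Pi.single i 1)).comp contDiff_fst

lemma contDiff_snd_apply (i : Fin n) :
    ContDiff ℝ ∞ (fun q : (Fin n → ℝ) × (Fin n → ℝ) => q.2 i) := by
  fun_prop

lemma fderiv_snd_apply (p w : (Fin n → ℝ) × (Fin n → ℝ)) (i : Fin n) :
    fderiv ℝ (fun q : (Fin n → ℝ) × (Fin n → ℝ) => q.2 i) p w = w.2 i := by
  have h := ((ContinuousLinearMap.proj (R := ℝ) (φ := fun _ : Fin n => ℝ) i).comp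
    (ContinuousLinearMap.snd ℝ (Fin n → ℝ) (Fin n → ℝ))).hasFDerivAt (x := p)
  exact congrArg (fun φ => φ w) h.fderiv

lemma fderiv_grad1_fst {V : (Fin n → ℝ) → ℝ} (hV : ContDiff ℝ ∞ V)
    (p w : (Fin n → ℝ) × (Fin n → ℝ)) (i : Fin n) :
    fderiv ℝ (fun q : (Fin n → ℝ) × (Fin n → ℝ) => grad1 V q.1 i) p w
      = fderiv ℝ (fun y => grad1 V y i) p.1 w.1 := by
  have h := ((hV.fderiv_apply_const (Pi.single i 1)).differentiable_of_infty p.1).hasFDerivAt.comp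
    p hasFDerivAt_fst
  exact congrArg (fun φ => φ w) h.fderiv

lemma kfp_sum {ι : Type*} (s : Finset ι) (V : (Fin n → ℝ) → ℝ)
    {F : ι → (Fin n → ℝ) × (Fin n → ℝ) → ℝ} (hF : ∀ k ∈ s, ContDiff ℝ ∞ (F k))
    (p : (Fin n → ℝ) × (Fin n → ℝ)) :
    kfp V (fun q => ∑ k ∈ s, F k q) p = ∑ k ∈ s, kfp V (F k) p := by
  have hx : ∀ q i, gradx (fun q => ∑ k ∈ s, F k q) q i = ∑ k ∈ s, gradx (F k) q i :=
    fun q i => fderiv_sum_apply hF q _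
  have hv : ∀ q i, gradv (fun q => ∑ k ∈ s, F k q) q i = ∑ k ∈ s, gradv (F k) q i :=
    fun q i => fderiv_sum_apply hF q _
  have hvv : ∀ i, gradv (fun q => ∑ k ∈ s, gradv (F k) q i) p i
      = ∑ k ∈ s, gradv (fun q => gradv (F k) q i) p i :=
    fun i => fderiv_sum_apply (fun k hk => contDiff_gradv (hF k hk) i) p _
  simp only [kfp, lapv, hx, hv, hvv, Finset.mul_sum, Finset.sum_add_distrib,
    Finset.sum_sub_distrib]
  congr 1
  · congr 1
    · congr 1
      · exact Finset.sum_comm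
      · exact Finset.sum_comm
    · exact Finset.sum_comm
  · exact Finset.sum_comm

lemma kfp_add (V : (Fin n → ℝ) → ℝ) {f g : (Fin n → ℝ) × (Fin n → ℝ) → ℝ}
    (hf : ContDiff ℝ ∞ f) (hg : ContDiff ℝ ∞ g) (p : (Fin n → ℝ) × (Fin n → ℝ)) :
    kfp V (fun q => f q + g q) p = kfp V f p + kfp V g p := by
  have h := kfp_sum Finset.univ V (F := fun b : Bool => if b then f else g)
    (by rintro (_ | _) - <;> simpa) p
  simpa using h

lemma kfp_mul_self (V : (Fin n → ℝ) → ℝ) {g : (Fin n → ℝ) × (Fin n → ℝ) → ℝ}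
    (hg : ContDiff ℝ ∞ g) (p : (Fin n → ℝ) × (Fin n → ℝ)) :
    kfp V (fun q => g q * g q) p = 2 * (g p * kfp V g p) + 2 * ∑ i, gradv g p i ^ 2 := by
  have hx : ∀ q i, gradx (fun q => g q * g q) q i = gradx g q i * g q + g q * gradx g q i :=
    fun q i => fderiv_mul_apply hg hg q _
  have hv : ∀ q i, gradv (fun q => g q * g q) q i = 2 * g q * gradv g q i := fun q i => by
    refine (fderiv_mul_apply hg hg q _).trans ?_
    simp only [gradv]
    ring
  have hvv : ∀ i, gradv (fun q => 2 * g q * gradv g q i) p i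
      = 2 * gradv g p i ^ 2 + 2 * g p * gradv (fun q => gradv g q i) p i := fun i => by
    refine (fderiv_mul_apply (contDiff_const.mul hg) (contDiff_gradv hg i) p _).trans ?_
    rw [fderiv_mul_apply contDiff_const hg]
    simp only [gradv, fderiv_fun_const, Pi.zero_apply, zero_apply]
    ring
  simp only [kfp, lapv, hx, hv, hvv, mul_add, mul_sub, Finset.mul_sum,
    ← Finset.sum_add_distrib, ← Finset.sum_sub_distrib]
  exact Finset.sum_congr rfl fun i _ => by ring

/-- The commutator of a constant vector field `w` with the kinetic Fokker–Planck operator. -/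
lemma fderiv_kfp {V : (Fin n → ℝ) → ℝ} (hV : ContDiff ℝ ∞ V)
    {f : (Fin n → ℝ) × (Fin n → ℝ) → ℝ} (hf : ContDiff ℝ ∞ f)
    (p w : (Fin n → ℝ) × (Fin n → ℝ)) :
    fderiv ℝ (kfp V f) p w = kfp V (fun q => fderiv ℝ f q w) p
      - ∑ i, w.2 i * gradv f p i + ∑ i, fderiv ℝ (fun y => grad1 V y i) p.1 w.1 * gradv f p i
      - ∑ i, w.2 i * gradx f p i := by
  have hL : kfp V f = fun q => ∑ i, (gradv (fun q => gradv f q i) q i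
      + (-1) * (q.2 i * gradv f q i) + grad1 V q.1 i * gradv f q i
      + (-1) * (q.2 i * gradx f q i)) := by
    funext q
    simp only [kfp, lapv, ← Finset.sum_add_distrib, ← Finset.sum_sub_distrib]
    exact Finset.sum_congr rfl fun i _ => by ring
  have c1 := fun i => contDiff_gradv (contDiff_gradv hf i) i
  have c2 := fun i => (contDiff_snd_apply i).mul (contDiff_gradv hf i)
  have c2' := fun i => (contDiff_const (c := (-1 : ℝ))).mul (c2 i)
  have c3 := fun i => (contDiff_grad1_fst hV i).mul (contDiff_gradv hf i)
  have c4 := fun i => (contDiff_snd_apply i).mul (contDiff_gradx hf i)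
  have c4' := fun i => (contDiff_const (c := (-1 : ℝ))).mul (c4 i)
  have hx : ∀ q i, fderiv ℝ (fun q => gradx f q i) q w = gradx (fun q => fderiv ℝ f q w) q i :=
    fun q i => fderiv_fderiv_apply_comm hf _ _ _
  have hv : ∀ q i, fderiv ℝ (fun q => gradv f q i) q w = gradv (fun q => fderiv ℝ f q w) q i :=
    fun q i => fderiv_fderiv_apply_comm hf _ _ _
  have hvv : ∀ i, fderiv ℝ (fun q => gradv (fun q => gradv f q i) q i) p w
      = gradv (fun q => gradv (fun q => fderiv ℝ f q w) q i) p i := fun i => by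
    refine (fderiv_fderiv_apply_comm (contDiff_gradv hf i) _ _ _).trans ?_
    simp only [hv]
    rfl
  rw [hL, fderiv_sum_apply fun i _ => (((c1 i).add (c2' i)).add (c3 i)).add (c4' i)]
  simp only [kfp, lapv, ← Finset.sum_add_distrib, ← Finset.sum_sub_distrib]
  refine Finset.sum_congr rfl fun i _ => ?_
  rw [fderiv_fun_add ((((c1 i).add (c2' i)).add (c3 i)).differentiable_of_infty p)
      ((c4' i).differentiable_of_infty p),
    fderiv_fun_add (((c1 i).add (c2' i)).differentiable_of_infty p)
      ((c3 i).differentiable_of_infty p),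
    fderiv_fun_add ((c1 i).differentiable_of_infty p) ((c2' i).differentiable_of_infty p)]
  simp only [add_apply]
  rw [fderiv_mul_apply contDiff_const (c2 i), fderiv_mul_apply contDiff_const (c4 i),
    fderiv_mul_apply (contDiff_snd_apply i) (contDiff_gradv hf i),
    fderiv_mul_apply (contDiff_snd_apply i) (contDiff_gradx hf i),
    fderiv_mul_apply (contDiff_grad1_fst hV i) (contDiff_gradv hf i),
    fderiv_snd_apply, fderiv_grad1_fst hV, hvv, hx, hv]
  simp only [fderiv_fun_const, Pi.zero_apply, zero_apply]
  ring

/-- The contribution of the vector field `a ∂ₓᵢ + b ∂ᵥᵢ` to the iterated form. -/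
lemma kfp_sq_sub_ge {V : (Fin n → ℝ) → ℝ} (hV : ContDiff ℝ ∞ V)
    {f : (Fin n → ℝ) × (Fin n → ℝ) → ℝ} (hf : ContDiff ℝ ∞ f) (a b : ℝ)
    (p : (Fin n → ℝ) × (Fin n → ℝ)) (i : Fin n) :
    2 * ((a * gradx f p i + b * gradv f p i)
        * (b * gradv f p i + b * gradx f p i - a * ∑ j, hess V p.1 i j * gradv f p j))
      ≤ kfp V (fun q => (a * gradx f q i + b * gradv f q i)
          * (a * gradx f q i + b * gradv f q i)) p
        - 2 * ((a * gradx f p i + b * gradv f p i)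
          * (a * gradx (kfp V f) p i + b * gradv (kfp V f) p i)) := by
  simp only [mul_gradx_add_mul_gradv a b]
  rw [fderiv_kfp hV hf, kfp_mul_self V (hf.fderiv_apply_const _)]
  have h1 : ∀ j, (a • ((Pi.single i 1, 0) : (Fin n → ℝ) × (Fin n → ℝ))
      + b • (0, Pi.single i 1)).2 j = if j = i then b else 0 := fun j => by
    simp [Pi.single_apply]
  have h2 : (a • ((Pi.single i 1, 0) : (Fin n → ℝ) × (Fin n → ℝ))
      + b • (0, Pi.single i 1)).1 = a • Pi.single i 1 := by simp
  simp only [h1, h2, map_smul, smul_eq_mul, ite_mul, zero_mul, Finset.sum_ite_eq',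
    Finset.mem_univ, if_true, mul_assoc, ← Finset.mul_sum]
  have h3 : ∑ j, fderiv ℝ (fun y => grad1 V y j) p.1 (Pi.single i 1) * gradv f p j
      = ∑ j, hess V p.1 i j * gradv f p j := rfl
  rw [h3]
  have h4 := Finset.sum_nonneg fun (j : Fin n) (_ : j ∈ Finset.univ) => sq_nonneg
    (gradv (fun q => fderiv ℝ f q (a • (Pi.single i 1, 0) + b • (0, Pi.single i 1))) p j)
  linarith

end KineticFokkerPlanck

/-- Pointwise lower bound on the iterated form `T₂` for the kinetic Fokker–Planck
operator with smooth potential `V`, the key computational step in the proof of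
exponential Wasserstein contraction. -/
theorem stmt5 {n : ℕ} (V : (Fin n → ℝ) → ℝ) (hV : ContDiff ℝ ∞ V)
    (α β γ δ : ℝ) (f : (Fin n → ℝ) × (Fin n → ℝ) → ℝ) (hf : ContDiff ℝ ∞ f)
    (p : (Fin n → ℝ) × (Fin n → ℝ)) :
    T2form V α β γ δ f p ≥
      (β ^ 2 + δ ^ 2) * ∑ i, (gradv f p i) ^ 2
      + (α * β + γ * δ) * ∑ i, (gradx f p i) ^ 2
      + (β ^ 2 + δ ^ 2 + α * β + γ * δ) * ∑ i, gradv f p i * gradx f p i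
      - (α ^ 2 + γ ^ 2) * ∑ i, ∑ j, hess V p.1 i j * gradv f p j * gradx f p i
      - (α * β + γ * δ) * ∑ i, ∑ j, hess V p.1 i j * gradv f p j * gradv f p i := by
  have hc : ∀ (a b : ℝ) (i : Fin n), ContDiff ℝ ∞ (fun q =>
      (a * gradx f q i + b * gradv f q i) * (a * gradx f q i + b * gradv f q i)) := fun a b i =>
    ((contDiff_const.mul (contDiff_gradx hf i)).add
      (contDiff_const.mul (contDiff_gradv hf i))).mul
    ((contDiff_const.mul (contDiff_gradx hf i)).add
      (contDiff_const.mul (contDiff_gradv hf i)))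
  have hk : kfp V (fun q => Tform α β γ δ f f q) p = _ :=
    kfp_sum Finset.univ V (fun i _ => (hc α β i).add (hc γ δ i)) p
  rw [T2form, hk, Tform]
  simp only [Finset.mul_sum, ← Finset.sum_add_distrib, ← Finset.sum_sub_distrib, ge_iff_le]
  refine Finset.sum_le_sum fun i _ => ?_
  have h1 := kfp_sq_sub_ge hV hf α β p i
  have h2 := kfp_sq_sub_ge hV hf γ δ p i
  rw [kfp_add V (hc α β i) (hc γ δ i)]
  have h3 : ∀ c d : ℝ, ∑ j, c * (hess V p.1 i j * gradv f p j * d)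
      = c * d * ∑ j, hess V p.1 i j * gradv f p j := fun c d => by
    rw [Finset.mul_sum]
    exact Finset.sum_congr rfl fun j _ => by ring
  rw [h3, h3]
  linarith

end
end
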